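/- Full statement of Lemma 'every extender is derived': for any transitive sets X and Y and any homomorphism of 𝒫-structures h : 𝒫_X → 𝒫_Y, there exists a transitive class M and an elementary embedding j : V → M such that Y ⊆ j(X) and h(A) = j(A) ∩ Y^{<ω} for every A ⊆ X^{<ω}. -/

import Mathlib

open FirstOrder

namespace WVP

/-- `tup X k`: the set of `k`-tuples (as lists) of elements of the ZF-set `X`. -/
def tup (X : ZFSet) (k : ℕ) : Set (List ZFSet) := {l | l.length = k ∧ ∀ z ∈ l, z ∈ X}

/-- `finTup X`: the set of all finite tuples from `X`, i.e. `X^{<ω}`. -/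
def finTup (X : ZFSet) : Set (List ZFSet) := {l | ∀ z ∈ l, z ∈ X}

/-- `WFset A`: `A` is well-founded under the reverse of the proper-initial-segment
relation, i.e. there is no infinite chain `a₁ ⊊ a₂ ⊊ ⋯` of elements of `A`. -/
def WFset (A : Set (List ZFSet)) : Prop :=
  ¬ ∃ g : ℕ → List ZFSet, (∀ n, g n ∈ A) ∧ ∀ n, g n <+: g (n + 1) ∧ g n ≠ g (n + 1)

/-- The coordinate projection `(x₁,…,x_k) ↦ (x_{i₁},…,x_{i_j})` (0-based indices). -/
def proj (is : List ℕ) (l : List ZFSet) : List ZFSet := is.map fun i => l.getD i ∅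

/-- The inverse image operator `Proj⁻¹_{k,(i₁,…,i_j)}` of the coordinate projection
`proj is : X^k → X^j`, mapping subsets of `X^j` to subsets of `X^k`. -/
def ProjInv (X : ZFSet) (k : ℕ) (is : List ℕ) (A : Set (List ZFSet)) : Set (List ZFSet) :=
  {l | l ∈ tup X k ∧ proj is l ∈ A}

/-- The bounded projection operator `BP_k` on subsets of `X^{k+1}`:
`BP_k(A) = {(x₁,…,x_{k+1}) ∈ X^{k+1} : ∃ z ∈ x_{k+1}, (x₁,…,x_k,z) ∈ A}`. -/
def BP (X : ZFSet) (k : ℕ) (A : Set (List ZFSet)) : Set (List ZFSet) :=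
  {l | l ∈ tup X (k + 1) ∧ ∃ z, z ∈ l.getLastD ∅ ∧ l.dropLast ++ [z] ∈ A}

/-- A homomorphism of 𝒫-structures `𝒫_X → 𝒫_Y`: a Boolean algebra homomorphism
`𝒫(X^{<ω}) → 𝒫(Y^{<ω})` sending `X^k` to `Y^k`, preserving the well-foundedness
predicate `WF` (forward direction), and commuting with the inverse-projection
operators `Proj⁻¹` and the bounded projection operators `BP_k`. -/
structure IsPHom (X Y : ZFSet) (h : Set (List ZFSet) → Set (List ZFSet)) : Prop where
  subset_finTup : ∀ A ⊆ finTup X, h A ⊆ finTup Y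
  map_inter : ∀ A ⊆ finTup X, ∀ B ⊆ finTup X, h (A ∩ B) = h A ∩ h B
  map_compl : ∀ A ⊆ finTup X, h (finTup X \ A) = finTup Y \ h A
  map_const : ∀ k, h (tup X k) = tup Y k
  map_wf : ∀ A ⊆ finTup X, WFset A → WFset (h A)
  map_projInv : ∀ (j k : ℕ) (is : List ℕ), is.length = j → (∀ i ∈ is, i < k) →
    ∀ A ⊆ tup X j, h (ProjInv X k is A) = ProjInv Y k is (h A)
  map_bp : ∀ (k : ℕ), ∀ A ⊆ tup X (k + 1), h (BP X k A) = BP Y k (h A)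

/-- The type of relation symbols of the language of set theory: a single binary
relation (membership). -/
inductive memRel : ℕ → Type
  | mem : memRel 2

/-- The first-order language with a single binary relation symbol `∈`. -/
def ZFLang : FirstOrder.Language := ⟨fun _ => Empty, memRel⟩

instance : ZFLang.Structure ZFSet where
  funMap := fun f _ => f.elim
  RelMap := fun r x => match r with | .mem => x 0 ∈ x 1

instance (M : Set ZFSet) : ZFLang.Structure M where
  funMap := fun f _ => f.elim
  RelMap := fun r x => match r with | .mem => (x 0 : ZFSet) ∈ (x 1 : ZFSet)

/-- `M` is a transitive class of ZF-sets. -/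
def ClassTransitive (M : Set ZFSet) : Prop := ∀ x ∈ M, ∀ y ∈ x, y ∈ M

/-- `j : V → M` is an elementary embedding of the set-theoretic universe into the
class `M` (elementary with respect to the language of set theory). -/
def Elementary (M : Set ZFSet) (j : ZFSet → ZFSet) : Prop :=
  ∃ hj : ∀ x, j x ∈ M, ∀ (n : ℕ) (φ : ZFLang.Formula (Fin n)) (v : Fin n → ZFSet),
    φ.Realize v ↔ φ.Realize fun i => (⟨j (v i), hj (v i)⟩ : M)

attribute [local instance] Classical.propDecidable

noncomputable instance (n : ℕ) (F : (Fin n → ZFSet) → ZFSet) : ZFSet.Definable n F :=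
  Classical.allZFSetDefinable F

/-- Coding of a finite tuple of ZF-sets as a single ZF-set, by iterated
Kuratowski pairing: `⟨⟩ ↦ ∅`, `(x, l) ↦ pair x (code l)`. -/
def listCode : List ZFSet → ZFSet
  | [] => ∅
  | x :: l => ZFSet.pair x (listCode l)

/-- The ZF-set `X^k` of (codes of) `k`-tuples from `X`. -/
def kTupZ (X : ZFSet) : ℕ → ZFSet
  | 0 => {∅}
  | k + 1 => ZFSet.sep (fun z => ∃ x ∈ X, ∃ t ∈ kTupZ X k, z = ZFSet.pair x t)
      (ZFSet.powerset (ZFSet.powerset (X ∪ kTupZ X k)))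

/-- The ZF-set `X^{<ω}` of (codes of) all finite tuples from `X`. -/
noncomputable def finTupZ (X : ZFSet) : ZFSet :=
  ZFSet.sUnion (ZFSet.range fun k : ℕ => kTupZ X k)

/-- The ZF-set coding a collection `A` of finite tuples from `X`. -/
noncomputable def codeZ (X : ZFSet) (A : Set (List ZFSet)) : ZFSet :=
  ZFSet.sep (fun z => ∃ l ∈ A, z = listCode l) (finTupZ X)

section Proof

variable {X Y : ZFSet.{0}} {h : Set (List ZFSet.{0}) → Set (List ZFSet.{0})}

theorem h_empty (hh : IsPHom X Y h) : h ∅ = ∅ := by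
  have h1 := hh.map_inter ∅ (Set.empty_subset _) (finTup X \ ∅) Set.sdiff_subset
  rw [Set.empty_inter, hh.map_compl ∅ (Set.empty_subset _)] at h1
  rw [h1]; ext x; simp

theorem h_mono (hh : IsPHom X Y h) {A B : Set (List ZFSet.{0})} (hB : B ⊆ finTup X)
    (hAB : A ⊆ B) : h A ⊆ h B := by
  have h1 := hh.map_inter A (hAB.trans hB) B hB
  rw [Set.inter_eq_left.2 hAB] at h1
  rw [h1]; exact Set.inter_subset_right

theorem tup_sub (X : ZFSet.{0}) (k : ℕ) : tup X k ⊆ finTup X := fun _ hl => hl.2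

theorem getD_idx (d : List ZFSet.{0}) (s : ZFSet.{0} → ZFSet.{0}) {y : ZFSet.{0}} (hy : y ∈ d) :
    (d.map s).getD (d.idxOf y) ∅ = s y := by
  have := List.idxOf_lt_length_of_mem hy
  rw [List.getD_eq_getElem _ _ (by simpa using this)]
  simp

theorem pull (hh : IsPHom X Y h) {b d : List ZFSet.{0}} (hd : d ∈ finTup Y) (hbd : ∀ y ∈ b, y ∈ d)
    {A : Set (List ZFSet.{0})} (hA : A ⊆ finTup X) (hb : b ∈ h A) :
    ∃ A' ⊆ tup X d.length, d ∈ h A' ∧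
      ∀ l ∈ A', b.map (fun y => l.getD (d.idxOf y) ∅) ∈ A := by
  have hbY : b ∈ finTup Y := hh.subset_finTup A hA hb
  have hb2 : b ∈ h (A ∩ tup X b.length) := by
    rw [hh.map_inter A hA _ (tup_sub X _), hh.map_const]
    exact ⟨hb, rfl, hbY⟩
  refine ⟨ProjInv X d.length (b.map d.idxOf) (A ∩ tup X b.length), fun l hl => hl.1, ?_, ?_⟩
  · rw [hh.map_projInv b.length d.length _ (by simp) _ _ Set.inter_subset_right]
    · refine ⟨⟨rfl, hd⟩, ?_⟩
      have : proj (b.map d.idxOf) d = b := by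
        simp only [proj, List.map_map]
        conv_rhs => rw [← List.map_id b]
        refine List.map_congr_left fun y hy => ?_
        have := getD_idx d id (hbd y hy)
        simpa using this
      rw [this]; exact hb2
    · intro i hi
      obtain ⟨y, hy, rfl⟩ := List.mem_map.1 hi
      exact List.idxOf_lt_length_of_mem (hbd y hy)
  · intro l hl
    have := hl.2.1
    simpa only [proj, List.map_map, Function.comp_def] using this

/-- The filter on functions generated by `h`. -/
def FF (hh : IsPHom X Y h) : Filter (ZFSet.{0} → ZFSet.{0}) where
  sets := {B | ∃ b A, A ⊆ finTup X ∧ b ∈ h A ∧ ∀ s : ZFSet.{0} → ZFSet.{0}, b.map s ∈ A → s ∈ B}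
  univ_sets := ⟨[], tup X 0, tup_sub X 0, by rw [hh.map_const]; simp [tup], fun _ _ => trivial⟩
  sets_of_superset := by
    rintro B C ⟨b, A, h1, h2, h3⟩ hBC
    exact ⟨b, A, h1, h2, fun s hs => hBC (h3 s hs)⟩
  inter_sets := by
    rintro B C ⟨b, A, h1, h2, h3⟩ ⟨c, A', h1', h2', h3'⟩
    have hb := hh.subset_finTup _ h1 h2
    have hc := hh.subset_finTup _ h1' h2'
    have hd : b ++ c ∈ finTup Y := by
      intro z hz
      rcases List.mem_append.1 hz with hz | hz
      · exact hb z hz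
      · exact hc z hz
    obtain ⟨D, hD1, hD2, hD3⟩ := pull hh hd (fun y hy => List.mem_append_left _ hy) h1 h2
    obtain ⟨D', hD1', hD2', hD3'⟩ := pull hh hd (fun y hy => List.mem_append_right _ hy) h1' h2'
    refine ⟨b ++ c, D ∩ D', fun l hl => tup_sub X _ (hD1 hl.1), ?_, ?_⟩
    · rw [hh.map_inter _ (hD1.trans (tup_sub X _)) _ (hD1'.trans (tup_sub X _))]
      exact ⟨hD2, hD2'⟩
    · intro s hs
      refine ⟨h3 s ?_, h3' s ?_⟩
      · have := hD3 _ hs.1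
        rwa [List.map_congr_left (g := s)] at this
        intro y hy
        exact getD_idx _ s (List.mem_append_left _ hy)
      · have := hD3' _ hs.2
        rwa [List.map_congr_left (g := s)] at this
        intro y hy
        exact getD_idx _ s (List.mem_append_right _ hy)

theorem ev_def (hh : IsPHom X Y h) {P : (ZFSet.{0} → ZFSet.{0}) → Prop} :
    (∀ᶠ s in FF hh, P s) ↔ ∃ b A, A ⊆ finTup X ∧ b ∈ h A ∧
      ∀ s : ZFSet.{0} → ZFSet.{0}, b.map s ∈ A → P s := Iff.rfl

theorem FF_neBot (hh : IsPHom X Y h) : (FF hh).NeBot := by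
  rw [Filter.neBot_iff, Ne, ← Filter.empty_mem_iff_bot]
  rintro ⟨b, A, h1, h2, h3⟩
  obtain ⟨D, hD1, hD2, hD3⟩ := pull hh (hh.subset_finTup _ h1 h2) (fun y hy => hy) h1 h2
  have : D.Nonempty := by
    rw [Set.nonempty_iff_ne_empty]
    rintro rfl
    rw [h_empty hh] at hD2
    exact hD2
  obtain ⟨l, hl⟩ := this
  exact h3 _ (hD3 l hl)

theorem ev_finTup (hh : IsPHom X Y h) {b : List ZFSet.{0}} (hb : b ∈ finTup Y) :
    ∀ᶠ s in FF hh, b.map s ∈ finTup X := by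
  refine ⟨b, tup X b.length, tup_sub X _, ?_, fun s hs => hs.2⟩
  rw [hh.map_const]; exact ⟨rfl, hb⟩

theorem ev_iff (hh : IsPHom X Y h) {b : List ZFSet.{0}} (hb : b ∈ finTup Y)
    {A : Set (List ZFSet.{0})} (hA : A ⊆ finTup X) :
    (∀ᶠ s in FF hh, b.map s ∈ A) ↔ b ∈ h A := by
  refine ⟨fun H => ?_, fun H => ⟨b, A, hA, H, fun s hs => hs⟩⟩
  by_contra hn
  have h2 : ∀ᶠ s in FF hh, b.map s ∈ finTup X \ A := by
    refine ⟨b, finTup X \ A, Set.sdiff_subset, ?_, fun s hs => hs⟩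
    rw [hh.map_compl A hA]; exact ⟨hb, hn⟩
  have := FF_neBot hh
  obtain ⟨s, hs1, hs2⟩ := (H.and h2).exists
  exact hs2.2 hs1

/-- `f` depends only on the values of its argument on `b`. -/
def Supp {α : Type*} (b : List ZFSet.{0}) (f : (ZFSet.{0} → ZFSet.{0}) → α) : Prop :=
  ∀ s t, (∀ y ∈ b, s y = t y) → f s = f t

theorem Supp.mono {α : Type*} {b c : List ZFSet.{0}} {f : (ZFSet.{0} → ZFSet.{0}) → α}
    (hf : Supp b f) (hbc : ∀ y ∈ b, y ∈ c) : Supp c f :=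
  fun s t hst => hf s t fun y hy => hst y (hbc y hy)

theorem Supp.factor {α : Type*} {b : List ZFSet.{0}} {f : (ZFSet.{0} → ZFSet.{0}) → α}
    (hf : Supp b f) : ∃ f' : List ZFSet.{0} → α, ∀ s, f s = f' (b.map s) := by
  refine ⟨fun l => f (fun y => l.getD (b.idxOf y) ∅), fun s => hf _ _ fun y hy => ?_⟩
  exact (getD_idx b s hy).symm

theorem ultra (hh : IsPHom X Y h) {b : List ZFSet.{0}} (hb : b ∈ finTup Y)
    {P : (ZFSet.{0} → ZFSet.{0}) → Prop} (hP : Supp b P) (hn : ¬ ∀ᶠ s in FF hh, P s) :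
    ∀ᶠ s in FF hh, ¬ P s := by
  obtain ⟨P', hP'⟩ := hP.factor
  have h1 : b ∉ h {l ∈ finTup X | P' l} := by
    rw [← ev_iff hh hb (fun l hl => hl.1)]
    intro H
    apply hn
    filter_upwards [H] with s hs
    rw [hP']; exact hs.2
  refine ⟨b, finTup X \ {l ∈ finTup X | P' l}, Set.sdiff_subset, ?_, ?_⟩
  · rw [hh.map_compl _ (fun l hl => hl.1)]
    exact ⟨hb, h1⟩
  · intro s hs
    change ¬ P s
    rw [hP']
    exact fun h3 => hs.2 ⟨hs.1, h3⟩

/-- Terms: finitely supported functions. -/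
abbrev T (Y : ZFSet.{0}) := {f : (ZFSet.{0} → ZFSet.{0}) → ZFSet.{0} // ∃ b ∈ finTup Y, Supp b f}

theorem finTup_append {b c : List ZFSet.{0}} (hb : b ∈ finTup Y) (hc : c ∈ finTup Y) :
    b ++ c ∈ finTup Y := by
  intro z hz
  rcases List.mem_append.1 hz with hz | hz
  · exact hb z hz
  · exact hc z hz

theorem common {n : ℕ} (v : Fin n → T Y) : ∃ b ∈ finTup Y, ∀ i, Supp b (v i).1 := by
  choose b hb hs using fun i => (v i).2
  refine ⟨(List.ofFn b).flatten, ?_, fun i => (hs i).mono fun y hy => ?_⟩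
  · intro z hz
    obtain ⟨l, hl, hz⟩ := List.mem_flatten.1 hz
    obtain ⟨i, rfl⟩ := (List.mem_ofFn' _ _).1 hl
    exact hb i z hz
  · exact List.mem_flatten.2 ⟨b i, (List.mem_ofFn' _ _).2 ⟨i, rfl⟩, hy⟩

theorem common2 (f g : T Y) : ∃ b ∈ finTup Y, Supp b f.1 ∧ Supp b g.1 := by
  obtain ⟨b, hb, hs⟩ := common ![f, g]
  exact ⟨b, hb, hs 0, hs 1⟩

theorem pair_ne_empty (x y : ZFSet.{0}) : ZFSet.pair x y ≠ ∅ := by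
  intro H
  have : ({x} : ZFSet.{0}) ∈ ZFSet.pair x y := by simp [ZFSet.pair]
  rw [H] at this
  exact ZFSet.notMem_empty _ this

theorem listCode_inj : ∀ l l' : List ZFSet.{0}, listCode l = listCode l' → l = l'
  | [], [], _ => rfl
  | [], _ :: _, H => (pair_ne_empty _ _ H.symm).elim
  | _ :: _, [], H => (pair_ne_empty _ _ H).elim
  | x :: l, x' :: l', H => by
    obtain ⟨h1, h2⟩ := ZFSet.pair_inj.1 H
    rw [h1, listCode_inj l l' h2]

theorem mem_kTupZ (X : ZFSet.{0}) : ∀ (k : ℕ) (z : ZFSet.{0}),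
    z ∈ kTupZ X k ↔ ∃ l ∈ tup X k, z = listCode l
  | 0, z => by
    simp only [kTupZ, ZFSet.mem_singleton]
    constructor
    · rintro rfl; exact ⟨[], by simp [tup], rfl⟩
    · rintro ⟨l, hl, rfl⟩
      obtain rfl := List.length_eq_zero_iff.1 hl.1
      rfl
  | k + 1, z => by
    simp only [kTupZ, ZFSet.mem_sep]
    constructor
    · rintro ⟨-, x, hx, t, ht, rfl⟩
      obtain ⟨l, hl, rfl⟩ := (mem_kTupZ X k t).1 ht
      refine ⟨x :: l, ⟨by simp [hl.1], ?_⟩, rfl⟩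
      intro w hw
      rcases List.mem_cons.1 hw with rfl | hw
      · exact hx
      · exact hl.2 w hw
    · rintro ⟨l, hl, rfl⟩
      match l, hl with
      | [], hl => simp [tup] at hl
      | x :: l, hl =>
        have hx : x ∈ X := hl.2 x (by simp)
        have ht : listCode l ∈ kTupZ X k := (mem_kTupZ X k _).2
          ⟨l, ⟨by simpa using hl.1, fun w hw => hl.2 w (by simp [hw])⟩, rfl⟩
        refine ⟨?_, x, hx, _, ht, rfl⟩
        rw [ZFSet.mem_powerset]
        intro w hw
        rw [ZFSet.mem_powerset]
        intro u hu
        simp only [listCode, ZFSet.pair, ZFSet.mem_pair] at hw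
        rw [ZFSet.mem_union]
        rcases hw with rfl | rfl
        · rw [ZFSet.mem_singleton] at hu; subst hu; exact Or.inl hx
        · rcases ZFSet.mem_pair.1 hu with rfl | rfl
          · exact Or.inl hx
          · exact Or.inr ht

theorem mem_finTupZ (X z : ZFSet.{0}) : z ∈ finTupZ X ↔ ∃ l ∈ finTup X, z = listCode l := by
  simp only [finTupZ, ZFSet.mem_sUnion, ZFSet.mem_range]
  constructor
  · rintro ⟨_, ⟨k, rfl⟩, hz⟩
    obtain ⟨l, hl, rfl⟩ := (mem_kTupZ X k z).1 hz
    exact ⟨l, hl.2, rfl⟩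
  · rintro ⟨l, hl, rfl⟩
    exact ⟨_, ⟨l.length, rfl⟩, (mem_kTupZ X _ _).2 ⟨l, ⟨rfl, hl⟩, rfl⟩⟩

theorem mem_codeZ {A : Set (List ZFSet.{0})} (hA : A ⊆ finTup X) (z : ZFSet.{0}) :
    z ∈ codeZ X A ↔ ∃ l ∈ A, z = listCode l := by
  simp only [codeZ, ZFSet.mem_sep, mem_finTupZ]
  constructor
  · exact fun H => H.2
  · rintro ⟨l, hl, rfl⟩; exact ⟨⟨l, hA hl, rfl⟩, l, hl, rfl⟩

theorem small_finTup (X : ZFSet.{0}) : Small.{0} {l // l ∈ finTup X} := by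
  let g : {l // l ∈ finTup X} → {z // z ∈ finTupZ X} :=
    fun l => ⟨listCode l.1, (mem_finTupZ X _).2 ⟨l.1, l.2, rfl⟩⟩
  have hs : Small.{0} {z // z ∈ finTupZ X} := ZFSet.small_coe (finTupZ X)
  refine small_of_injective (f := g) ?_
  intro a b hab
  exact Subtype.ext (listCode_inj _ _ (congrArg Subtype.val hab))

/-- Membership of terms. -/
def memT (hh : IsPHom X Y h) (f g : T Y) : Prop := ∀ᶠ s in FF hh, f.1 s ∈ g.1 s

theorem memT_wf (hh : IsPHom X Y h) : WellFounded (memT hh) := by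
  rw [wellFounded_iff_isEmpty_descending_chain]
  refine ⟨fun ⟨f, hf⟩ => ?_⟩
  have hNe := FF_neBot hh
  choose b hb hs using fun n => (f n).2
  by_cases hY0 : ∃ y0, y0 ∈ Y
  · obtain ⟨y0, hy0⟩ := hY0
    let c : ℕ → List ZFSet.{0} := fun n => Nat.rec (b 0) (fun n r => r ++ (y0 :: b (n + 1))) n
    have hc1 : ∀ n, c (n + 1) = c n ++ (y0 :: b (n + 1)) := fun n => rfl
    have hcY : ∀ n, c n ∈ finTup Y := by
      intro n
      induction n with
      | zero => exact hb 0
      | succ n ih =>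
        rw [hc1]
        refine finTup_append ih ?_
        intro z hz
        rcases List.mem_cons.1 hz with rfl | hz
        · exact hy0
        · exact hb _ z hz
    have hsc : ∀ n, Supp (c n) (f n).1 := by
      intro n
      cases n with
      | zero => exact hs 0
      | succ n =>
        refine (hs (n + 1)).mono fun y hy => ?_
        rw [hc1]; simp [hy]
    have hpre : ∀ m n, m ≤ n → c m <+: c n := by
      intro m n hmn
      induction n, hmn using Nat.le_induction with
      | base => exact List.prefix_rfl
      | succ n _ ih => exact ih.trans (by rw [hc1]; exact List.prefix_append _ _)
    have hlen : StrictMono fun n => (c n).length := by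
      refine strictMono_nat_of_lt_succ fun n => ?_
      simp [hc1]
    choose g hg using fun n => (hsc n).factor
    let A : Set (List ZFSet.{0}) := {l ∈ finTup X | ∀ i, (c (i + 1)).length ≤ l.length →
      g (i + 1) (l.take (c (i + 1)).length) ∈ g i (l.take (c i).length)}
    have hA : A ⊆ finTup X := fun l hl => hl.1
    have hAwf : WFset A := by
      rintro ⟨a, ha, hch⟩
      have hl : ∀ m, m ≤ (a m).length := by
        intro m
        induction m with
        | zero => simp
        | succ m ih =>
          have h1 := (hch m).1.length_le
          have h2 : (a m).length ≠ (a (m + 1)).length :=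
            fun H => (hch m).2 ((hch m).1.eq_of_length H)
          omega
      have hp : ∀ m n, m ≤ n → a m <+: a n := by
        intro m n hmn
        induction n, hmn using Nat.le_induction with
        | base => exact List.prefix_rfl
        | succ n _ ih => exact ih.trans (hch n).1
      have htake : ∀ k m, k ≤ m → (a m).take k = (a k).take k := by
        intro k m hkm
        obtain ⟨r, hr⟩ := hp k m hkm
        rw [← hr, List.take_append_of_le_length (hl k)]
      refine (wellFounded_iff_isEmpty_descending_chain.1 ZFSet.mem_wf).false
        ⟨fun i => g i ((a (c i).length).take (c i).length), fun i => ?_⟩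
      have h1 := (ha (c (i + 1)).length).2 i (hl _)
      rw [htake (c i).length (c (i + 1)).length (hlen.monotone (Nat.le_succ i))] at h1
      exact h1
    refine hh.map_wf A hA hAwf ⟨c, fun n => ?_, fun n => ⟨hpre n (n + 1) (Nat.le_succ n), fun H => ?_⟩⟩
    · rw [← ev_iff hh (hcY n) hA]
      have hall : ∀ᶠ s in FF hh, ∀ i ∈ Finset.range n, (f (i + 1)).1 s ∈ (f i).1 s := by
        rw [Filter.eventually_all_finset]
        exact fun i _ => hf i
      filter_upwards [ev_finTup hh (hcY n), hall] with s hs1 hs2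
      refine ⟨hs1, fun i hi => ?_⟩
      have hin : i + 1 ≤ n := by
        rw [List.length_map] at hi
        exact hlen.le_iff_le.1 hi
      have htk : ∀ m ≤ n, (List.map s (c n)).take (c m).length = (c m).map s := by
        intro m hm
        rw [← List.map_take, ← List.prefix_iff_eq_take.1 (hpre m n hm)]
      rw [htk _ hin, htk i (by omega), ← hg, ← hg]
      exact hs2 i (by simpa using hin)
    · have := hlen (Nat.lt_succ_self n)
      simp only [Nat.succ_eq_add_one, ← H, lt_irrefl] at this
  · have hb0 : ∀ n, b n = [] := fun n =>
      List.eq_nil_iff_forall_not_mem.2 fun y hy => hY0 ⟨y, hb n y hy⟩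
    refine (wellFounded_iff_isEmpty_descending_chain.1 ZFSet.mem_wf).false
        ⟨fun i => (f i).1 id, fun i => ?_⟩
    obtain ⟨s, hs1⟩ := (hf i).exists
    have e : ∀ n, (f n).1 s = (f n).1 id := fun n => hs n _ _ (by simp [hb0 n])
    rw [e, e] at hs1
    exact hs1

/-- Almost everywhere equality. -/
def stT (hh : IsPHom X Y h) : Setoid (T Y) where
  r f g := ∀ᶠ s in FF hh, f.1 s = g.1 s
  iseqv := ⟨fun _ => Filter.Eventually.of_forall fun _ => rfl,
    fun H => H.mono fun _ hs => hs.symm,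
    fun H H' => (H.and H').mono fun _ hs => hs.1.trans hs.2⟩

/-- Membership on the quotient. -/
def RQ (hh : IsPHom X Y h) (p q : Quotient (stT hh)) : Prop := memT hh p.out q.out

theorem out_ev (hh : IsPHom X Y h) (f : T Y) :
    ∀ᶠ s in FF hh, (Quotient.mk (stT hh) f).out.1 s = f.1 s :=
  Quotient.exact (s := stT hh) (Quotient.out_eq _)

theorem RQ_mk (hh : IsPHom X Y h) (f g : T Y) :
    RQ hh (Quotient.mk (stT hh) f) (Quotient.mk (stT hh) g) ↔ memT hh f g := by
  have e := (out_ev hh f).and (out_ev hh g)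
  refine Filter.eventually_congr (e.mono fun s hs => ?_)
  rw [hs.1, hs.2]

theorem RQ_wf (hh : IsPHom X Y h) : WellFounded (RQ hh) :=
  InvImage.wf (fun q : Quotient (stT hh) => q.out) (memT_wf hh)

theorem RQ_small (hh : IsPHom X Y h) (q : Quotient (stT hh)) :
    Small.{0} {p // RQ hh p q} := by
  have i1 := small_finTup X
  have i2 := small_finTup Y
  obtain ⟨f, rfl⟩ := Quotient.exists_rep q
  obtain ⟨b, hb, hs⟩ := f.2
  obtain ⟨f', hf'⟩ := hs.factor
  let W : ZFSet.{0} := insert ∅ (ZFSet.sUnion (ZFSet.range fun l : {l // l ∈ finTup X} => f' l.1))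
  have i3 : Small.{0} {z // z ∈ W} := ZFSet.small_coe W
  let G : {c // c ∈ finTup Y} × ({l // l ∈ finTup X} → {z // z ∈ W}) → Quotient (stT hh) :=
    fun p => Quotient.mk (stT hh) ⟨fun s => if H : p.1.1.map s ∈ finTup X then (p.2 ⟨_, H⟩).1 else ∅,
      p.1.1, p.1.2, fun s t hst => by
        dsimp only; rw [List.map_congr_left hst]⟩
  have hsm : Small.{0} (Set.range G) := small_range G
  refine @small_subset.{0} _ (Set.range G) {p | RQ hh p (Quotient.mk (stT hh) f)} ?_ hsm
  intro p hp
  obtain ⟨g, rfl⟩ := Quotient.exists_rep p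
  have hp : memT hh g f := (RQ_mk hh g f).1 hp
  obtain ⟨c, hc, hsc⟩ := g.2
  obtain ⟨g', hg'⟩ := hsc.factor
  refine ⟨(⟨c, hc⟩, fun l => if H : g' l.1 ∈ W then ⟨g' l.1, H⟩ else ⟨∅, by simp [W]⟩), ?_⟩
  refine Quotient.sound (s := stT hh) ?_
  filter_upwards [hp, ev_finTup hh hb, ev_finTup hh hc] with s h1 h2 h3
  have h4 : g' (c.map s) ∈ W := by
    rw [hf', hg'] at h1
    refine ZFSet.mem_insert_of_mem _ (ZFSet.mem_sUnion.2 ⟨_, ?_, h1⟩)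
    exact ZFSet.mem_range.2 ⟨⟨_, h2⟩, rfl⟩
  simp only [h3, h4, dif_pos, hg']

theorem collapse {α : Type*} {r : α → α → Prop} (hr : WellFounded r)
    (hs : ∀ a, Small.{0} {b // r b a}) :
    ∃ p : α → ZFSet.{0}, ∀ a x, x ∈ p a ↔ ∃ b, r b a ∧ x = p b := by
  refine ⟨hr.fix fun a F => ZFSet.range fun b : {b // r b a} => F b.1 b.2, fun a x => ?_⟩
  rw [hr.fix_eq, ZFSet.mem_range]
  constructor
  · rintro ⟨⟨b, hb⟩, rfl⟩; exact ⟨b, hb, rfl⟩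
  · rintro ⟨b, hb, rfl⟩; exact ⟨⟨b, hb⟩, rfl⟩

theorem exists_pi (hh : IsPHom X Y h) : ∃ p : T Y → ZFSet.{0},
    (∀ f x, x ∈ p f ↔ ∃ g, memT hh g f ∧ x = p g) ∧
    (∀ f g, (∀ᶠ s in FF hh, f.1 s = g.1 s) → p f = p g) := by
  obtain ⟨p, hp⟩ := collapse (RQ_wf hh) (RQ_small hh)
  refine ⟨fun f => p (Quotient.mk (stT hh) f), fun f x => ?_, fun f g hfg => ?_⟩
  · rw [hp]
    constructor
    · rintro ⟨q, hq, rfl⟩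
      obtain ⟨g, rfl⟩ := Quotient.exists_rep q
      exact ⟨g, (RQ_mk hh g f).1 hq, rfl⟩
    · rintro ⟨g, hg, rfl⟩
      exact ⟨_, (RQ_mk hh g f).2 hg, rfl⟩
  · exact congrArg p (Quotient.sound (s := stT hh) hfg)

/-- A term from a function and a support. -/
def mkT (f : (ZFSet.{0} → ZFSet.{0}) → ZFSet.{0}) (hf : ∃ b ∈ finTup Y, Supp b f) : T Y := ⟨f, hf⟩

/-- Constant term. -/
def cT (Y x : ZFSet.{0}) : T Y := ⟨fun _ => x, [], by simp [finTup], fun _ _ _ => rfl⟩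

/-- Evaluation term. -/
def eT {y : ZFSet.{0}} (hy : y ∈ Y) : T Y :=
  ⟨fun s => s y, [y], by simpa [finTup] using hy, fun _ _ H => H y (by simp)⟩

theorem Supp.op2 {α β γ : Type*} {b : List ZFSet.{0}} {f : (ZFSet.{0} → ZFSet.{0}) → α}
    {g : (ZFSet.{0} → ZFSet.{0}) → β} (hf : Supp b f) (hg : Supp b g) (o : α → β → γ) :
    Supp b (fun s => o (f s) (g s)) := by
  intro s t H
  dsimp only
  rw [hf s t H, hg s t H]

theorem pi_inj (hh : IsPHom X Y h) {p : T Y → ZFSet.{0}}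
    (hp : ∀ f x, x ∈ p f ↔ ∃ g, memT hh g f ∧ x = p g) (f : T Y) :
    ∀ g, p f = p g → ∀ᶠ s in FF hh, f.1 s = g.1 s := by
  have hNe := FF_neBot hh
  induction f using (memT_wf hh).induction with
  | _ f ih =>
  intro g hfg
  by_contra hn
  obtain ⟨b, hb, hsf, hsg⟩ := common2 f g
  have h1 := ultra hh hb (P := fun s => f.1 s = g.1 s) (hsf.op2 hsg _) hn
  let d : ZFSet.{0} → ZFSet.{0} → ZFSet.{0} := fun x y =>
    Classical.epsilon fun z => ¬ (z ∈ x ↔ z ∈ y)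
  have hd : ∀ x y, x ≠ y → ¬ (d x y ∈ x ↔ d x y ∈ y) := by
    intro x y hxy
    refine Classical.epsilon_spec (p := fun z => ¬ (z ∈ x ↔ z ∈ y)) ?_
    by_contra H
    push Not at H
    exact hxy (ZFSet.ext H)
  let t : T Y := ⟨fun s => d (f.1 s) (g.1 s), b, hb, hsf.op2 hsg d⟩
  have hts : Supp b t.1 := hsf.op2 hsg d
  have h2 : ∀ᶠ s in FF hh, ¬ (t.1 s ∈ f.1 s ↔ t.1 s ∈ g.1 s) := h1.mono fun s hs => hd _ _ hs
  by_cases h3 : memT hh t f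
  · have h4 : p t ∈ p f := (hp f _).2 ⟨t, h3, rfl⟩
    rw [hfg] at h4
    obtain ⟨t', ht', e⟩ := (hp g _).1 h4
    have h5 := ih t h3 t' e
    obtain ⟨s, s1, s2, s3, s4⟩ := (h2.and (h3.and (h5.and ht'))).exists
    rw [← s3] at s4
    exact s1 ⟨fun _ => s4, fun _ => s2⟩
  · have h3' := ultra hh hb (P := fun s => t.1 s ∈ f.1 s) (hts.op2 hsf (fun x y => x ∈ y)) h3
    have h6 : memT hh t g := by
      filter_upwards [h2, h3'] with s s1 s2
      by_contra s3
      exact s1 ⟨fun H => (s2 H).elim, fun H => (s3 H).elim⟩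
    have h4 : p t ∈ p g := (hp g _).2 ⟨t, h6, rfl⟩
    rw [← hfg] at h4
    obtain ⟨t', ht', e⟩ := (hp f _).1 h4
    have h5 := ih t' ht' t e.symm
    obtain ⟨s, s1, s2, s3⟩ := (h3'.and (h5.and ht')).exists
    rw [s2] at s3
    exact s1 s3

theorem pi_mem (hh : IsPHom X Y h) {p : T Y → ZFSet.{0}}
    (hp : ∀ f x, x ∈ p f ↔ ∃ g, memT hh g f ∧ x = p g) (f g : T Y) :
    p f ∈ p g ↔ ∀ᶠ s in FF hh, f.1 s ∈ g.1 s := by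
  constructor
  · intro H
    obtain ⟨t, ht, e⟩ := (hp g _).1 H
    filter_upwards [ht, pi_inj hh hp f t e] with s h1 h2
    rw [h2]; exact h1
  · exact fun H => (hp g _).2 ⟨f, H, rfl⟩

theorem term_realize {α : Type} {n : ℕ} (p : T Y → ZFSet.{0})
    (t : ZFLang.Term (α ⊕ Fin n)) (v : α → T Y) (xs : Fin n → T Y) :
    ∃ f : T Y, (∀ s, t.realize (Sum.elim (fun i => (v i).1 s) (fun i => (xs i).1 s)) = f.1 s) ∧
      t.realize (Sum.elim (fun i => (⟨p (v i), Set.mem_range_self _⟩ : Set.range p))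
        (fun i => (⟨p (xs i), Set.mem_range_self _⟩ : Set.range p))) = ⟨p f, Set.mem_range_self _⟩ := by
  cases t with
  | var i =>
    cases i with
    | inl i => exact ⟨v i, fun s => rfl, rfl⟩
    | inr i => exact ⟨xs i, fun s => rfl, rfl⟩
  | func f _ => exact Empty.elim f

theorem los (hh : IsPHom X Y h) {p : T Y → ZFSet.{0}}
    (hp : ∀ f x, x ∈ p f ↔ ∃ g, memT hh g f ∧ x = p g)
    (hp' : ∀ f g, (∀ᶠ s in FF hh, f.1 s = g.1 s) → p f = p g)
    {m n : ℕ} (φ : ZFLang.BoundedFormula (Fin m) n) (v : Fin m → T Y) (xs : Fin n → T Y) :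
    φ.Realize (fun i => (⟨p (v i), Set.mem_range_self _⟩ : Set.range p))
        (fun i => (⟨p (xs i), Set.mem_range_self _⟩ : Set.range p)) ↔
      ∀ᶠ s in FF hh, φ.Realize (fun i => (v i).1 s) (fun i => (xs i).1 s) := by
  have hNe := FF_neBot hh
  have hsup : ∀ {n : ℕ} (φ : ZFLang.BoundedFormula (Fin m) n) (xs : Fin n → T Y),
      ∃ b ∈ finTup Y, (Supp b fun s => fun i => (v i).1 s) ∧ Supp b fun s => fun i => (xs i).1 s := by
    intro n φ xs
    obtain ⟨b, hb, h1⟩ := common v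
    obtain ⟨c, hc, h2⟩ := common xs
    refine ⟨b ++ c, finTup_append hb hc, fun s t H => funext fun i => ?_,
      fun s t H => funext fun i => ?_⟩
    · exact (h1 i).mono (fun y hy => List.mem_append_left _ hy) s t H
    · exact (h2 i).mono (fun y hy => List.mem_append_right _ hy) s t H
  induction φ with
  | falsum =>
    simp only [FirstOrder.Language.BoundedFormula.Realize, Filter.eventually_false_iff_eq_bot]
    exact ⟨False.elim, fun H => hNe.ne H⟩
  | equal t₁ t₂ =>
    obtain ⟨f, hf1, hf2⟩ := term_realize p t₁ v xs
    obtain ⟨g, hg1, hg2⟩ := term_realize p t₂ v xs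
    simp only [FirstOrder.Language.BoundedFormula.Realize, hf1, hg1, hf2, hg2]
    exact ⟨fun H => pi_inj hh hp f g (congrArg Subtype.val H), fun H => Subtype.ext (hp' f g H)⟩
  | rel R ts =>
    cases R
    obtain ⟨f, hf1, hf2⟩ := term_realize p (ts 0) v xs
    obtain ⟨g, hg1, hg2⟩ := term_realize p (ts 1) v xs
    have := pi_mem hh hp f g
    change ((ts 0).realize _ : Set.range p).1 ∈ ((ts 1).realize _ : Set.range p).1 ↔
      ∀ᶠ s in FF hh, (ts 0).realize _ ∈ (ts 1).realize _
    simp only [hf1, hg1, hf2, hg2]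
    exact this
  | imp φ ψ ih1 ih2 =>
    simp only [FirstOrder.Language.BoundedFormula.realize_imp]
    refine (imp_congr (ih1 xs) (ih2 xs)).trans ?_
    constructor
    · intro H
      obtain ⟨b, hb, h1, h2⟩ := hsup φ xs
      by_cases h3 : ∀ᶠ s in FF hh, φ.Realize (fun i => (v i).1 s) (fun i => (xs i).1 s)
      · exact (H h3).mono fun s hs _ => hs
      · have := ultra hh hb (h1.op2 h2 (fun a b => φ.Realize a b)) h3
        exact this.mono fun s hs hs' => (hs hs').elim
    · intro H H'
      exact (H.and H').mono fun s hs => hs.1 hs.2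
  | all φ ih =>
    simp only [FirstOrder.Language.BoundedFormula.realize_all]
    have key : ∀ t : T Y, φ.Realize (fun i => (⟨p (v i), Set.mem_range_self _⟩ : Set.range p))
        (Fin.snoc (α := fun _ => Set.range p)
          (fun i => (⟨p (xs i), Set.mem_range_self _⟩ : Set.range p)) ⟨p t, Set.mem_range_self _⟩) ↔
      ∀ᶠ s in FF hh, φ.Realize (fun i => (v i).1 s)
        (Fin.snoc (α := fun _ => ZFSet.{0}) (fun i => (xs i).1 s) (t.1 s)) := by
      intro t
      have := ih (Fin.snoc (α := fun _ => T Y) xs t)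
      convert this using 2
      · funext i
        refine Fin.lastCases ?_ (fun i => ?_) i <;> simp
      · funext s
        congr 1
        funext i
        refine Fin.lastCases ?_ (fun i => ?_) i <;> simp
    constructor
    · intro H
      by_contra hn
      obtain ⟨b, hb, h1, h2⟩ := hsup φ.all xs
      have h3 := ultra hh hb (h1.op2 h2 (fun a b => ∀ x, φ.Realize a (Fin.snoc b x))) hn
      let d := fun (a : Fin m → ZFSet.{0}) (b : Fin _ → ZFSet.{0}) =>
        Classical.epsilon fun x => ¬ φ.Realize a (Fin.snoc b x)
      let t : T Y := ⟨_, b, hb, h1.op2 h2 d⟩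
      obtain ⟨⟨s, h4⟩, h5⟩ : (∃ s, _) ∧ True := ⟨(((key t).1 (H _)).and h3).exists, trivial⟩
      obtain ⟨h6, h7⟩ := h4
      push Not at h7
      exact Classical.epsilon_spec h7 h6
    · rintro H ⟨_, t, rfl⟩
      exact (key t).2 (H.mono fun s hs => hs _)

theorem ev_mem_of_mem (hh : IsPHom X Y h) (hY : Y.IsTransitive)
    {y z : ZFSet.{0}} (hy : y ∈ Y) (hz : z ∈ y) : ∀ᶠ s in FF hh, s z ∈ s y := by
  have hzY : z ∈ Y := hY.mem_trans hz hy
  let D : Set (List ZFSet.{0}) := {l | ∃ x ∈ X, l = [x, x]}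
  have hD : D ⊆ tup X 2 := by
    rintro l ⟨x, hx, rfl⟩
    exact ⟨rfl, by simpa using hx⟩
  have h1 : [z, z] ∈ h D := by
    have hzz : [z, z] ∈ finTup Y := by simpa [finTup] using hzY
    rw [← ev_iff hh hzz (hD.trans (tup_sub X 2))]
    filter_upwards [ev_finTup hh hzz] with s hs
    exact ⟨s z, hs _ (by simp), rfl⟩
  have hzy : [z, y] ∈ finTup Y := by simp [finTup, hzY, hy]
  have h2 : [z, y] ∈ h (BP X 1 D) := by
    rw [hh.map_bp 1 D hD]
    exact ⟨⟨rfl, hzy⟩, z, hz, h1⟩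
  rw [← ev_iff hh hzy (fun l hl => hl.1.2)] at h2
  filter_upwards [h2] with s hs
  obtain ⟨-, w, hw, x, hx, e⟩ := hs
  simp at hw e
  rw [e.1, ← e.2]
  exact hw

theorem ev_eq_of_mem (hh : IsPHom X Y h) (hX : X.IsTransitive) (hY : Y.IsTransitive)
    {y : ZFSet.{0}} (hy : y ∈ Y) (t : T Y) (ht : ∀ᶠ s in FF hh, t.1 s ∈ s y) :
    ∃ z ∈ y, ∀ᶠ s in FF hh, t.1 s = s z := by
  obtain ⟨c, hc, hs⟩ := t.2
  obtain ⟨t', ht'⟩ := hs.factor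
  let D : Set (List ZFSet.{0}) := {l | l ∈ tup X (c.length + 1) ∧ t' l.dropLast = l.getLastD ∅}
  have hD : D ⊆ tup X (c.length + 1) := fun l hl => hl.1
  have hcy : ∀ z ∈ Y, c ++ [z] ∈ finTup Y := fun z hz =>
    finTup_append hc (by simpa [finTup] using hz)
  have h1 : c ++ [y] ∈ h (BP X c.length D) := by
    rw [← ev_iff hh (hcy y hy) (fun l hl => hl.1.2)]
    filter_upwards [ev_finTup hh (hcy y hy), ht] with s s1 s2
    have s3 : s y ∈ X := s1 _ (by simp)
    have s4 : t.1 s ∈ X := hX.mem_trans s2 s3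
    refine ⟨⟨by simp, s1⟩, t.1 s, by simpa using s2, ⟨by simp, ?_⟩, ?_⟩
    · refine finTup_append (fun z hz => s1 z ?_) (by simpa [finTup] using s4)
      simp only [List.map_append, List.map_cons, List.map_nil, List.dropLast_concat] at hz
      rw [List.map_append]
      exact List.mem_append_left _ hz
    · simp [ht']
  rw [hh.map_bp _ D hD] at h1
  obtain ⟨-, z, hz, h2⟩ := h1
  simp only [List.getLastD_concat, List.dropLast_concat] at hz h2
  refine ⟨z, hz, ?_⟩
  rw [← ev_iff hh (hcy z (hY.mem_trans hz hy)) (hD.trans (tup_sub X _))] at h2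
  filter_upwards [h2] with s s1
  have := s1.2
  simpa [ht'] using this

theorem pi_eval (hh : IsPHom X Y h) (hX : X.IsTransitive) (hY : Y.IsTransitive)
    {p : T Y → ZFSet.{0}} (hp : ∀ f x, x ∈ p f ↔ ∃ g, memT hh g f ∧ x = p g)
    (hp' : ∀ f g, (∀ᶠ s in FF hh, f.1 s = g.1 s) → p f = p g) (y : ZFSet.{0}) :
    ∀ hy : y ∈ Y, p (eT hy) = y := by
  induction y using ZFSet.inductionOn with
  | _ y ih =>
  intro hy
  ext x
  rw [hp]
  constructor
  · rintro ⟨t, ht, rfl⟩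
    obtain ⟨z, hz, e⟩ := ev_eq_of_mem hh hX hY hy t ht
    have hzY : z ∈ Y := hY.mem_trans hz hy
    rw [hp' t (eT hzY) e, ih z hz hzY]
    exact hz
  · intro hx
    have hxY : x ∈ Y := hY.mem_trans hx hy
    exact ⟨eT hxY, ev_mem_of_mem hh hY hy hx, (ih x hx hxY).symm⟩

theorem pi_upair (hh : IsPHom X Y h)
    {p : T Y → ZFSet.{0}} (hp : ∀ f x, x ∈ p f ↔ ∃ g, memT hh g f ∧ x = p g)
    (hp' : ∀ f g, (∀ᶠ s in FF hh, f.1 s = g.1 s) → p f = p g) (f g k : T Y)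
    (hk : ∀ s, k.1 s = {f.1 s, g.1 s}) : p k = {p f, p g} := by
  ext x
  rw [hp, ZFSet.mem_pair]
  constructor
  · rintro ⟨t, ht, rfl⟩
    by_cases H : ∀ᶠ s in FF hh, t.1 s = f.1 s
    · exact Or.inl (hp' _ _ H)
    · right
      obtain ⟨b, hb, h1, h2⟩ := common2 t f
      have H' := ultra hh hb (P := fun s => t.1 s = f.1 s) (h1.op2 h2 _) H
      refine hp' _ _ ?_
      filter_upwards [H', ht] with s s1 s2
      rw [hk, ZFSet.mem_pair] at s2
      exact s2.resolve_left s1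
  · rintro (rfl | rfl)
    · exact ⟨f, Filter.Eventually.of_forall fun s => by rw [hk]; simp, rfl⟩
    · exact ⟨g, Filter.Eventually.of_forall fun s => by rw [hk]; simp, rfl⟩

theorem pi_pair (hh : IsPHom X Y h)
    {p : T Y → ZFSet.{0}} (hp : ∀ f x, x ∈ p f ↔ ∃ g, memT hh g f ∧ x = p g)
    (hp' : ∀ f g, (∀ᶠ s in FF hh, f.1 s = g.1 s) → p f = p g) (f g k : T Y)
    (hk : ∀ s, k.1 s = ZFSet.pair (f.1 s) (g.1 s)) : p k = ZFSet.pair (p f) (p g) := by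
  obtain ⟨b, hb, h1, h2⟩ := common2 f g
  let u : T Y := ⟨_, b, hb, h1.op2 h1 (fun x y => {x, y})⟩
  let w : T Y := ⟨_, b, hb, h1.op2 h2 (fun x y => {x, y})⟩
  have hu : p u = {p f, p f} := pi_upair hh hp hp' f f u fun s => rfl
  have hw : p w = {p f, p g} := pi_upair hh hp hp' f g w fun s => rfl
  rw [pi_upair hh hp hp' u w k, hu, hw, ZFSet.pair, ZFSet.pair_eq_singleton]
  intro s
  rw [hk, ZFSet.pair, ← ZFSet.pair_eq_singleton]

/-- Term for a coded list. -/
def lT (l : List ZFSet.{0}) (hl : l ∈ finTup Y) : T Y :=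
  ⟨fun s => listCode (l.map s), l, hl, fun s t H => by
    dsimp only; rw [List.map_congr_left H]⟩

theorem pi_list (hh : IsPHom X Y h) (hX : X.IsTransitive) (hY : Y.IsTransitive)
    {p : T Y → ZFSet.{0}} (hp : ∀ f x, x ∈ p f ↔ ∃ g, memT hh g f ∧ x = p g)
    (hp' : ∀ f g, (∀ᶠ s in FF hh, f.1 s = g.1 s) → p f = p g) (l : List ZFSet.{0}) :
    ∀ hl : l ∈ finTup Y, p (lT l hl) = listCode l := by
  have hNe := FF_neBot hh
  induction l with
  | nil =>
    intro hl
    ext x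
    rw [hp]
    constructor
    · rintro ⟨t, ht, -⟩
      obtain ⟨s, hs⟩ := ht.exists
      exact (ZFSet.notMem_empty _ hs).elim
    · intro hx
      exact (ZFSet.notMem_empty _ hx).elim
  | cons y l ih =>
    intro hl
    have hy : y ∈ Y := hl y (by simp)
    have hl' : l ∈ finTup Y := fun z hz => hl z (by simp [hz])
    rw [pi_pair hh hp hp' (eT hy) (lT l hl') _ (fun s => rfl), pi_eval hh hX hY hp hp' y hy,
      ih hl']
    rfl

end Proof

/-- Every extender is derived: for any transitive sets `X` and `Y` and any
homomorphism of 𝒫-structures `h : 𝒫_X → 𝒫_Y`, there exist a transitive class `M`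
and an elementary embedding `j : V → M` such that `Y ⊆ j(X)` and
`h(A) = j(A) ∩ Y^{<ω}` for every `A ⊆ X^{<ω}` (tuple sets being identified with
their Kuratowski ZF-set codes). -/
theorem every_extender_is_derived (X Y : ZFSet) (hX : X.IsTransitive)
    (hY : Y.IsTransitive) (h : Set (List ZFSet) → Set (List ZFSet))
    (hh : IsPHom X Y h) :
    ∃ (M : Set ZFSet) (j : ZFSet → ZFSet), ClassTransitive M ∧ Elementary M j ∧
      Y ⊆ j X ∧
      ∀ A ⊆ finTup X, j (codeZ X A) ∩ finTupZ Y = codeZ Y (h A) := by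
  have hNe := FF_neBot hh
  obtain ⟨p, hp, hp'⟩ := exists_pi hh
  refine ⟨Set.range p, fun x => p (cT Y x), ?_, ⟨fun x => ⟨_, rfl⟩, ?_⟩, ?_, ?_⟩
  · rintro _ ⟨f, rfl⟩ y hy
    obtain ⟨g, -, rfl⟩ := (hp f y).1 hy
    exact ⟨g, rfl⟩
  · intro n φ v
    have := los hh hp hp' φ (fun i => cT Y (v i)) (fun i => i.elim0)
    unfold FirstOrder.Language.Formula.Realize
    refine Iff.trans ?_ (this.symm.trans ?_)
    · exact ⟨fun H => Filter.Eventually.of_forall fun s => by convert H; rfl,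
        fun H => by obtain ⟨s, hs⟩ := H.exists; convert hs; rfl⟩
    · rw [iff_iff_eq]
      congr 1
      exact Subsingleton.elim _ _
  · intro y hy
    rw [← pi_eval hh hX hY hp hp' y hy, pi_mem hh hp]
    have : [y] ∈ finTup Y := by simpa [finTup] using hy
    filter_upwards [ev_finTup hh this] with s hs
    exact hs _ (by simp [eT])
  · intro A hA
    ext z
    rw [ZFSet.mem_inter, mem_finTupZ, mem_codeZ (hh.subset_finTup A hA)]
    have key : ∀ l (hl : l ∈ finTup Y), listCode l ∈ p (cT Y (codeZ X A)) ↔ l ∈ h A := by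
      intro l hl
      rw [← pi_list hh hX hY hp hp' l hl, pi_mem hh hp, ← ev_iff hh hl hA]
      refine Filter.eventually_congr (Filter.Eventually.of_forall fun s => ?_)
      simp only [lT, cT]
      rw [mem_codeZ hA]
      constructor
      · rintro ⟨l', hl', e⟩
        rw [listCode_inj _ _ e]; exact hl'
      · exact fun H => ⟨_, H, rfl⟩
    constructor
    · rintro ⟨h1, l, hl, rfl⟩
      exact ⟨l, (key l hl).1 h1, rfl⟩
    · rintro ⟨l, hl, rfl⟩
      have hl' := hh.subset_finTup A hA hl
      exact ⟨(key l hl').2 hl, l, hl', rfl⟩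

end WVP
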